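/- arXiv:2103.04592 — 3 statements merged into one kernel-verified Lean document; each statement's English description precedes it below -/
import Mathlib

section
/- Let W, T, V be pairwise disjoint finite sets and let V_WTV, V_T, V_V be vector spaces on W⊎T⊎V, T, and V respectively over a field F. Then {V_WTV, V_T ⊕ V_V} is rigid if and only if the three pairs {V_WTV, V_V}, {V_WTV ∩ V_V, V_T}, and {V_WTV + V_V, V_T} are all rigid, where V_WTV ∩ V_V and V_WTV + V_V are the extended intersection and sum on W⊎T⊎V, each paired with V_T with respect to the split W⊎V versus T. -/
namespace ILA

variable {F : Type*} [Field F]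

/-- Restriction of a collection on `X ⊎ Y` to its left component `X`. -/
def restrL {X Y : Type*} (K : Set (X ⊕ Y → F)) : Set (X → F) :=
  {f | ∃ g : Y → F, Sum.elim f g ∈ K}

/-- Contraction of a collection on `X ⊎ Y` to its left component `X`. -/
def contrL {X Y : Type*} (K : Set (X ⊕ Y → F)) : Set (X → F) :=
  {f | Sum.elim f (0 : Y → F) ∈ K}

/-- Restriction of a collection on `X ⊎ Y` to its right component `Y`. -/
def restrR {X Y : Type*} (K : Set (X ⊕ Y → F)) : Set (Y → F) :=
  {g | ∃ f : X → F, Sum.elim f g ∈ K}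

/-- Contraction of a collection on `X ⊎ Y` to its right component `Y`. -/
def contrR {X Y : Type*} (K : Set (X ⊕ Y → F)) : Set (Y → F) :=
  {g | Sum.elim (0 : X → F) g ∈ K}

/-- Matched composition of a collection on `S ⊎ P` with one on `P ⊎ Q`. -/
def matched {S P Q : Type*} (K₁ : Set (S ⊕ P → F)) (K₂ : Set (P ⊕ Q → F)) :
    Set (S ⊕ Q → F) :=
  {h | ∃ p : P → F, Sum.elim (h ∘ Sum.inl) p ∈ K₁ ∧ Sum.elim p (h ∘ Sum.inr) ∈ K₂}

/-- Skewed composition of a collection on `S ⊎ P` with one on `P ⊎ Q`. -/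
def skewed {S P Q : Type*} (K₁ : Set (S ⊕ P → F)) (K₂ : Set (P ⊕ Q → F)) :
    Set (S ⊕ Q → F) :=
  {h | ∃ p : P → F, Sum.elim (h ∘ Sum.inl) p ∈ K₁ ∧ Sum.elim (-p) (h ∘ Sum.inr) ∈ K₂}

/-- Matched composition of a collection on `S ⊎ P` with one on `P` (i.e. `Q = ∅`). -/
def matchedP {S P : Type*} (K₁ : Set (S ⊕ P → F)) (K₂ : Set (P → F)) : Set (S → F) :=
  {f | ∃ p ∈ K₂, Sum.elim f p ∈ K₁}

/-- Matched composition over the common left component `S` of collections on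
`S ⊎ P` and `S ⊎ Q`; the result lives on `P ⊎ Q`. -/
def matchedL {S P Q : Type*} (K₁ : Set (S ⊕ P → F)) (K₂ : Set (S ⊕ Q → F)) :
    Set (P ⊕ Q → F) :=
  {h | ∃ s : S → F, Sum.elim s (h ∘ Sum.inl) ∈ K₁ ∧ Sum.elim s (h ∘ Sum.inr) ∈ K₂}

/-- The collection of vectors orthogonal (w.r.t. the standard dot product)
to every vector of `K`. -/
def dualSet {X : Type*} [Fintype X] (K : Set (X → F)) : Set (X → F) :=
  {g | ∀ f ∈ K, ∑ x, f x * g x = 0}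

/-- The coset `a + K`. -/
def coset {X : Type*} (a : X → F) (K : Set (X → F)) : Set (X → F) :=
  {v | ∃ u ∈ K, v = a + u}

/-- Rank of a collection of vectors: the dimension of its span. -/
noncomputable def rk {X : Type*} (K : Set (X → F)) : ℕ :=
  Module.finrank F (Submodule.span F K)

/-- `R + L` is everything: the full sum property for a pair of collections on `Y`. -/
def FullSumSets {Y : Type*} (R L : Set (Y → F)) : Prop :=
  ∀ h : Y → F, ∃ u ∈ R, ∃ v ∈ L, h = u + v

/-- The vector on `S ⊎ P ⊎ Q` assembled from its three components. -/
def triple {S P Q : Type*} (f : S → F) (p : P → F) (g : Q → F) : S ⊕ (P ⊕ Q) → F :=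
  Sum.elim f (Sum.elim p g)

/-- Extended sum of collections on `S ⊎ P` and `P ⊎ Q`, living on `S ⊎ P ⊎ Q`. -/
def extSum {S P Q : Type*} (K₁ : Set (S ⊕ P → F)) (K₂ : Set (P ⊕ Q → F)) :
    Set (S ⊕ (P ⊕ Q) → F) :=
  {v | ∃ (f : S → F) (p₁ p₂ : P → F) (g : Q → F),
    Sum.elim f p₁ ∈ K₁ ∧ Sum.elim p₂ g ∈ K₂ ∧ v = triple f (p₁ + p₂) g}

/-- Extended intersection of collections on `S ⊎ P` and `P ⊎ Q`, living on `S ⊎ P ⊎ Q`. -/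
def extInter {S P Q : Type*} (K₁ : Set (S ⊕ P → F)) (K₂ : Set (P ⊕ Q → F)) :
    Set (S ⊕ (P ⊕ Q) → F) :=
  {v | ∃ (f : S → F) (p : P → F) (g : Q → F),
    Sum.elim f p ∈ K₁ ∧ Sum.elim p g ∈ K₂ ∧ v = triple f p g}

/-- Restriction of a collection on `S ⊎ P ⊎ Q` to `S ⊎ Q`. -/
def restrSQ {S P Q : Type*} (K : Set (S ⊕ (P ⊕ Q) → F)) : Set (S ⊕ Q → F) :=
  {w | ∃ p : P → F, triple (w ∘ Sum.inl) p (w ∘ Sum.inr) ∈ K}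

/-- Contraction of a collection on `S ⊎ P ⊎ Q` to `S ⊎ Q`. -/
def contrSQ {S P Q : Type*} (K : Set (S ⊕ (P ⊕ Q) → F)) : Set (S ⊕ Q → F) :=
  {w | triple (w ∘ Sum.inl) (0 : P → F) (w ∘ Sum.inr) ∈ K}

/-- `K_{(−P)Q}`: negate the `P`-components of all vectors of `K`. -/
def negL {P Q : Type*} (K : Set (P ⊕ Q → F)) : Set (P ⊕ Q → F) :=
  {v | Sum.elim (-(v ∘ Sum.inl)) (v ∘ Sum.inr) ∈ K}

/-- Direct sum of collections on `X` and on `Y`, living on `X ⊎ Y`. -/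
def dsum {X Y : Type*} (K₁ : Set (X → F)) (K₂ : Set (Y → F)) : Set (X ⊕ Y → F) :=
  {h | h ∘ Sum.inl ∈ K₁ ∧ h ∘ Sum.inr ∈ K₂}

/-- Matched composition of a collection on `W ⊎ T ⊎ V` with one on `V`,
yielding a collection on `W ⊎ T`. -/
def matchedTriple {W T V : Type*} (K : Set (W ⊕ (T ⊕ V) → F)) (L : Set (V → F)) :
    Set (W ⊕ T → F) :=
  {w | ∃ g ∈ L, Sum.elim (w ∘ Sum.inl) (Sum.elim (w ∘ Sum.inr) g) ∈ K}

/-- Extended sum of a collection on `W ⊎ T ⊎ V` with one on `V`. -/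
def extSumV {W T V : Type*} (K : Set (W ⊕ (T ⊕ V) → F)) (L : Set (V → F)) :
    Set (W ⊕ (T ⊕ V) → F) :=
  {v | ∃ u ∈ K, ∃ g ∈ L, v = u + Sum.elim (0 : W → F) (Sum.elim (0 : T → F) g)}

/-- Extended intersection of a collection on `W ⊎ T ⊎ V` with one on `V`. -/
def extInterV {W T V : Type*} (K : Set (W ⊕ (T ⊕ V) → F)) (L : Set (V → F)) :
    Set (W ⊕ (T ⊕ V) → F) :=
  {v | v ∈ K ∧ (fun x => v (Sum.inr (Sum.inr x))) ∈ L}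

/-- Restriction of a collection on `W ⊎ T ⊎ V` to `T`. -/
def restrT {W T V : Type*} (K : Set (W ⊕ (T ⊕ V) → F)) : Set (T → F) :=
  {t | ∃ (w : W → F) (v : V → F), Sum.elim w (Sum.elim t v) ∈ K}

/-- Contraction of a collection on `W ⊎ T ⊎ V` to `T`. -/
def contrT {W T V : Type*} (K : Set (W ⊕ (T ⊕ V) → F)) : Set (T → F) :=
  {t | Sum.elim (0 : W → F) (Sum.elim t (0 : V → F)) ∈ K}

/-- The image of a collection on `Y ⊎ Y` under the coordinate swap. -/
def swapSet {Y : Type*} (K : Set (Y ⊕ Y → F)) : Set (Y ⊕ Y → F) :=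
  (fun v => Sum.elim (v ∘ Sum.inr) (v ∘ Sum.inl)) '' K

/-- A collection on `Y ⊎ Y` is Dirac iff its swap equals its orthogonal complement. -/
def IsDirac {Y : Type*} [Fintype Y] (K : Set (Y ⊕ Y → F)) : Prop :=
  swapSet K = dualSet K

/-- `T` is column-independent in `K`: the only vector orthogonal to `K` and
supported inside `T` is zero. -/
def ColIndep {X : Type*} [Fintype X] (K : Set (X → F)) (T : Set X) : Prop :=
  ∀ g ∈ dualSet K, (∀ x ∉ T, g x = 0) → g = 0

/-- `T` is a column base of `K`: a column-independent set of size `rk K`. -/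
def IsColBase {X : Type*} [Fintype X] (K : Set (X → F)) (T : Set X) : Prop :=
  ColIndep K T ∧ T.ncard = rk K

section components

variable {W T V : Type*} (K : Submodule F (W ⊕ (T ⊕ V) → F))
  (A : Submodule F (T → F)) (B : Submodule F (V → F))

theorem add_components_mem {w₁ w₂ : W → F} {t₁ t₂ : T → F} {v₁ v₂ : V → F}
    (h₁ : Sum.elim w₁ (Sum.elim t₁ v₁) ∈ K) (h₂ : Sum.elim w₂ (Sum.elim t₂ v₂) ∈ K) :
    Sum.elim (w₁ + w₂) (Sum.elim (t₁ + t₂) (v₁ + v₂)) ∈ K := by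
  have h := K.add_mem h₁ h₂
  rwa [← Sum.elim_add_add, ← Sum.elim_add_add] at h

theorem fullSumSets_iff {Y : Type*} (R : Set (Y → F)) (L : Submodule F (Y → F)) :
    FullSumSets R (L : Set (Y → F)) ↔ ∀ h, ∃ u ∈ R, h - u ∈ L := by
  refine forall_congr' fun h => exists_congr fun u => and_congr_right fun _ => ?_
  constructor
  · rintro ⟨v, hv, rfl⟩
    simpa using hv
  · exact fun hu => ⟨h - u, hu, by abel⟩

theorem fullSumSets_dsum_iff :
    FullSumSets (restrR (K : Set (W ⊕ (T ⊕ V) → F))) (dsum (A : Set (T → F)) (B : Set (V → F))) ↔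
      ∀ t v, ∃ w t' v', Sum.elim w (Sum.elim t' v') ∈ K ∧ t - t' ∈ A ∧ v - v' ∈ B := by
  constructor
  · intro h t v
    obtain ⟨u, ⟨w, hu⟩, x, ⟨hxA, hxB⟩, he⟩ := h (Sum.elim t v)
    refine ⟨w, u ∘ Sum.inl, u ∘ Sum.inr, by simpa using hu, ?_, ?_⟩
    · rwa [show t - u ∘ Sum.inl = x ∘ Sum.inl from
        funext fun i => sub_eq_of_eq_add' (congrFun he (Sum.inl i))]
    · rwa [show v - u ∘ Sum.inr = x ∘ Sum.inr from
        funext fun i => sub_eq_of_eq_add' (congrFun he (Sum.inr i))]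
  · intro h x
    obtain ⟨w, t', v', hK, hA, hB⟩ := h (x ∘ Sum.inl) (x ∘ Sum.inr)
    refine ⟨Sum.elim t' v', ⟨w, hK⟩, x - Sum.elim t' v', ⟨hA, hB⟩, by abel⟩

theorem contrR_inter_dsum_eq_iff :
    contrR (K : Set (W ⊕ (T ⊕ V) → F)) ∩ dsum (A : Set (T → F)) (B : Set (V → F)) = {0} ↔
      ∀ t ∈ A, ∀ v ∈ B, Sum.elim (0 : W → F) (Sum.elim t v) ∈ K → t = 0 ∧ v = 0 := by
  have h0 : (0 : T ⊕ V → F) ∈ contrR (K : Set (W ⊕ (T ⊕ V) → F)) ∩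
      dsum (A : Set (T → F)) (B : Set (V → F)) :=
    ⟨by simp [contrR], A.zero_mem, B.zero_mem⟩
  rw [Set.eq_singleton_iff_unique_mem, and_iff_right h0]
  constructor
  · intro h t ht v hv hK
    have he := h (Sum.elim t v) ⟨hK, ht, hv⟩
    exact ⟨funext fun i => congrFun he (Sum.inl i), funext fun i => congrFun he (Sum.inr i)⟩
  · rintro h x ⟨hK, hA, hB⟩
    obtain ⟨ht, hv⟩ := h _ hA _ hB (by simpa [contrR] using hK)
    funext i
    rcases i with i | i
    exacts [congrFun ht i, congrFun hv i]

theorem contrR_contrR_inter_eq_iff :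
    contrR (contrR (K : Set (W ⊕ (T ⊕ V) → F))) ∩ (B : Set (V → F)) = {0} ↔
      ∀ v ∈ B, Sum.elim (0 : W → F) (Sum.elim (0 : T → F) v) ∈ K → v = 0 := by
  have h0 : (0 : V → F) ∈ contrR (contrR (K : Set (W ⊕ (T ⊕ V) → F))) ∩ (B : Set (V → F)) :=
    ⟨by simp [contrR], B.zero_mem⟩
  rw [Set.eq_singleton_iff_unique_mem, and_iff_right h0]
  exact ⟨fun h v hv hK => h v ⟨hK, hv⟩, fun h v hv => h v hv.2 hv.1⟩

theorem mem_restrT_extInterV {t : T → F} :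
    t ∈ restrT (extInterV (K : Set (W ⊕ (T ⊕ V) → F)) (B : Set (V → F))) ↔
      ∃ w, ∃ v ∈ B, Sum.elim w (Sum.elim t v) ∈ K :=
  exists_congr fun _ => exists_congr fun _ => and_comm

theorem mem_contrT_extInterV {t : T → F} :
    t ∈ contrT (extInterV (K : Set (W ⊕ (T ⊕ V) → F)) (B : Set (V → F))) ↔
      Sum.elim (0 : W → F) (Sum.elim t 0) ∈ K :=
  and_iff_left B.zero_mem

theorem mem_extSumV {w : W → F} {t : T → F} {v : V → F} :
    Sum.elim w (Sum.elim t v) ∈ extSumV (K : Set (W ⊕ (T ⊕ V) → F)) (B : Set (V → F)) ↔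
      ∃ g ∈ B, Sum.elim w (Sum.elim t (v - g)) ∈ K := by
  have key (g : V → F) : (Sum.elim w (Sum.elim t (v - g)) : W ⊕ (T ⊕ V) → F) =
      Sum.elim w (Sum.elim t v) - Sum.elim (0 : W → F) (Sum.elim (0 : T → F) g) := by
    rw [← Sum.elim_sub_sub, ← Sum.elim_sub_sub, sub_zero, sub_zero]
  constructor
  · rintro ⟨u, hu, g, hg, he⟩
    refine ⟨g, hg, ?_⟩
    rw [key, he, add_sub_cancel_right]
    exact hu
  · rintro ⟨g, hg, hK⟩
    exact ⟨_, hK, g, hg, by rw [key, sub_add_cancel]⟩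

theorem mem_restrT_extSumV {t : T → F} :
    t ∈ restrT (extSumV (K : Set (W ⊕ (T ⊕ V) → F)) (B : Set (V → F))) ↔
      ∃ w v, Sum.elim w (Sum.elim t v) ∈ K := by
  constructor
  · rintro ⟨w, v, h⟩
    obtain ⟨g, -, hK⟩ := (mem_extSumV K B).1 h
    exact ⟨w, v - g, hK⟩
  · rintro ⟨w, v, hK⟩
    exact ⟨w, v, (mem_extSumV K B).2 ⟨0, B.zero_mem, by rwa [sub_zero]⟩⟩

theorem mem_contrT_extSumV {t : T → F} :
    t ∈ contrT (extSumV (K : Set (W ⊕ (T ⊕ V) → F)) (B : Set (V → F))) ↔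
      ∃ g ∈ B, Sum.elim (0 : W → F) (Sum.elim t g) ∈ K := by
  refine (mem_extSumV K B).trans ⟨?_, ?_⟩
  · rintro ⟨g, hg, hK⟩
    exact ⟨-g, B.neg_mem hg, by rwa [← zero_sub]⟩
  · rintro ⟨g, hg, hK⟩
    exact ⟨-g, B.neg_mem hg, by rwa [zero_sub, neg_neg]⟩

end components

/-- `{V_WTV, V_T ⊕ V_V}` is rigid iff `{V_WTV, V_V}`, `{V_WTV ∩ V_V, V_T}` and
`{V_WTV + V_V, V_T}` are all rigid. -/
theorem rigid_decomposition_sum_inter {W T V : Type*} [Fintype W] [Fintype T] [Fintype V]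
    (Vwtv : Submodule F (W ⊕ (T ⊕ V) → F))
    (Vt : Submodule F (T → F)) (Vv : Submodule F (V → F)) :
    (FullSumSets (restrR (Vwtv : Set (W ⊕ (T ⊕ V) → F)))
        (dsum (Vt : Set (T → F)) (Vv : Set (V → F))) ∧
      contrR (Vwtv : Set (W ⊕ (T ⊕ V) → F))
        ∩ dsum (Vt : Set (T → F)) (Vv : Set (V → F)) = {0}) ↔
    ((FullSumSets (restrR (restrR (Vwtv : Set (W ⊕ (T ⊕ V) → F)))) (Vv : Set (V → F)) ∧
        contrR (contrR (Vwtv : Set (W ⊕ (T ⊕ V) → F))) ∩ (Vv : Set (V → F)) = {0}) ∧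
     (FullSumSets (restrT (extInterV (Vwtv : Set (W ⊕ (T ⊕ V) → F)) (Vv : Set (V → F))))
          (Vt : Set (T → F)) ∧
        contrT (extInterV (Vwtv : Set (W ⊕ (T ⊕ V) → F)) (Vv : Set (V → F)))
          ∩ (Vt : Set (T → F)) = {0}) ∧
     (FullSumSets (restrT (extSumV (Vwtv : Set (W ⊕ (T ⊕ V) → F)) (Vv : Set (V → F))))
          (Vt : Set (T → F)) ∧
        contrT (extSumV (Vwtv : Set (W ⊕ (T ⊕ V) → F)) (Vv : Set (V → F)))
          ∩ (Vt : Set (T → F)) = {0})) := by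
  rw [fullSumSets_dsum_iff, contrR_inter_dsum_eq_iff, contrR_contrR_inter_eq_iff,
    fullSumSets_iff, fullSumSets_iff, fullSumSets_iff,
    Set.eq_singleton_iff_unique_mem, Set.eq_singleton_iff_unique_mem]
  simp only [Set.mem_inter_iff, mem_restrT_extInterV, mem_contrT_extInterV, mem_restrT_extSumV,
    mem_contrT_extSumV, SetLike.mem_coe]
  constructor
  · rintro ⟨hfull, hzero⟩
    refine ⟨⟨fun v => ?_, fun v hv hK => (hzero 0 Vt.zero_mem v hv hK).2⟩,
      ⟨fun t => ?_, ⟨by simp, Vt.zero_mem⟩, fun t ht => (hzero t ht.2 0 Vv.zero_mem ht.1).1⟩,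
      fun t => ?_, ⟨⟨0, Vv.zero_mem, by simp⟩, Vt.zero_mem⟩, ?_⟩
    · obtain ⟨w, t', v', hK, -, hv⟩ := hfull 0 v
      exact ⟨v', ⟨t', w, hK⟩, hv⟩
    · obtain ⟨w, t', v', hK, ht, hv⟩ := hfull t 0
      exact ⟨t', ⟨w, v', by simpa using hv, hK⟩, ht⟩
    · obtain ⟨w, t', v', hK, ht, -⟩ := hfull t 0
      exact ⟨t', ⟨w, v', hK⟩, ht⟩
    · rintro t ⟨⟨g, hg, hK⟩, ht⟩
      exact (hzero t ht g hg hK).1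
  · rintro ⟨⟨hfullV, hzeroV⟩, ⟨hfullT, -⟩, -, -, hzeroT⟩
    refine ⟨fun t v => ?_, fun t ht v hv hK => ?_⟩
    · obtain ⟨v₁, ⟨t₁, w₁, hK₁⟩, hv₁⟩ := hfullV v
      obtain ⟨t₂, ⟨w₂, v₂, hv₂, hK₂⟩, ht₂⟩ := hfullT (t - t₁)
      refine ⟨w₁ + w₂, t₁ + t₂, v₁ + v₂, add_components_mem Vwtv hK₁ hK₂, ?_, ?_⟩
      · rwa [← sub_sub]
      · rw [← sub_sub]
        exact Vv.sub_mem hv₁ hv₂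
    · obtain rfl := hzeroT t ⟨⟨v, hv, hK⟩, ht⟩
      exact ⟨rfl, hzeroV v hv hK⟩

end ILA
end

section
/- Rigidity of a connection of two rigid multiports: Let A, B, C, D be pairwise disjoint finite sets, A₁ ⊆ A, C₁ ⊆ C, and let V_AB, V_CD, V_B, V_D, V_{A₁C₁} be vector spaces on A⊎B, C⊎D, B, D, and A₁⊎C₁ respectively over a field F. Then the pair {V_AB ⊕ V_CD, V_B ⊕ V_D ⊕ V_{A₁C₁}} (with respect to the split (A−A₁)⊎(C−C₁) versus B⊎D⊎A₁⊎C₁) is rigid if and only if the three pairs {V_AB, V_B}, {V_CD, V_D}, and {(V_AB ↔ V_B) ⊕ (V_CD ↔ V_D), V_{A₁C₁}} (the last with respect to the split (A−A₁)⊎(C−C₁) versus A₁⊎C₁) are all rigid. -/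
namespace ILA

variable {F : Type*} [Field F]

section Connection

variable {A₂ A₁ B C₂ C₁ D : Type*}

/-- Restriction to `B ⊎ D ⊎ A₁ ⊎ C₁` of the direct sum `V_AB ⊕ V_CD`, where
`A = A₂ ⊎ A₁` and `C = C₂ ⊎ C₁`. -/
def connRestr (KA : Set ((A₂ ⊕ A₁) ⊕ B → F)) (KC : Set ((C₂ ⊕ C₁) ⊕ D → F)) :
    Set ((B ⊕ D) ⊕ (A₁ ⊕ C₁) → F) :=
  {h | ∃ (a : A₂ → F) (c : C₂ → F),
    Sum.elim (Sum.elim a (h ∘ Sum.inr ∘ Sum.inl)) (h ∘ Sum.inl ∘ Sum.inl) ∈ KA ∧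
    Sum.elim (Sum.elim c (h ∘ Sum.inr ∘ Sum.inr)) (h ∘ Sum.inl ∘ Sum.inr) ∈ KC}

/-- Contraction to `B ⊎ D ⊎ A₁ ⊎ C₁` of the direct sum `V_AB ⊕ V_CD`. -/
def connContr (KA : Set ((A₂ ⊕ A₁) ⊕ B → F)) (KC : Set ((C₂ ⊕ C₁) ⊕ D → F)) :
    Set ((B ⊕ D) ⊕ (A₁ ⊕ C₁) → F) :=
  {h | Sum.elim (Sum.elim (0 : A₂ → F) (h ∘ Sum.inr ∘ Sum.inl)) (h ∘ Sum.inl ∘ Sum.inl) ∈ KA ∧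
    Sum.elim (Sum.elim (0 : C₂ → F) (h ∘ Sum.inr ∘ Sum.inr)) (h ∘ Sum.inl ∘ Sum.inr) ∈ KC}

/-- The device characteristic `V_B ⊕ V_D ⊕ V_{A₁C₁}` on `B ⊎ D ⊎ A₁ ⊎ C₁`. -/
def connDevice (KB : Set (B → F)) (KD : Set (D → F)) (KAC : Set (A₁ ⊕ C₁ → F)) :
    Set ((B ⊕ D) ⊕ (A₁ ⊕ C₁) → F) :=
  {h | h ∘ Sum.inl ∘ Sum.inl ∈ KB ∧ h ∘ Sum.inl ∘ Sum.inr ∈ KD ∧ h ∘ Sum.inr ∈ KAC}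

/-- Restriction to `A₁ ⊎ C₁` of the direct sum `(V_AB ↔ V_B) ⊕ (V_CD ↔ V_D)`. -/
def portRestr (KA : Set ((A₂ ⊕ A₁) ⊕ B → F)) (KC : Set ((C₂ ⊕ C₁) ⊕ D → F))
    (KB : Set (B → F)) (KD : Set (D → F)) : Set (A₁ ⊕ C₁ → F) :=
  {h | ∃ (a : A₂ → F) (c : C₂ → F),
    (∃ b ∈ KB, Sum.elim (Sum.elim a (h ∘ Sum.inl)) b ∈ KA) ∧
    (∃ d ∈ KD, Sum.elim (Sum.elim c (h ∘ Sum.inr)) d ∈ KC)}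

/-- Contraction to `A₁ ⊎ C₁` of the direct sum `(V_AB ↔ V_B) ⊕ (V_CD ↔ V_D)`. -/
def portContr (KA : Set ((A₂ ⊕ A₁) ⊕ B → F)) (KC : Set ((C₂ ⊕ C₁) ⊕ D → F))
    (KB : Set (B → F)) (KD : Set (D → F)) : Set (A₁ ⊕ C₁ → F) :=
  {h | (∃ b ∈ KB, Sum.elim (Sum.elim (0 : A₂ → F) (h ∘ Sum.inl)) b ∈ KA) ∧
    (∃ d ∈ KD, Sum.elim (Sum.elim (0 : C₂ → F) (h ∘ Sum.inr)) d ∈ KC)}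

theorem elim_elim_add_mem {X Y Z : Type*} {V : Submodule F ((X ⊕ Y) ⊕ Z → F)}
    {x x' : X → F} {y y' : Y → F} {z z' : Z → F}
    (h : Sum.elim (Sum.elim x y) z ∈ V) (h' : Sum.elim (Sum.elim x' y') z' ∈ V) :
    Sum.elim (Sum.elim (x + x') (y + y')) (z + z') ∈ V := by
  have := V.add_mem h h'
  rwa [← Sum.elim_add_add, ← Sum.elim_add_add] at this

theorem inter_eq_singleton_zero_iff {X : Type*} {K L : Set (X → F)}
    (hK : (0 : X → F) ∈ K) (hL : (0 : X → F) ∈ L) :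
    K ∩ L = {0} ↔ ∀ x ∈ K, x ∈ L → x = 0 := by
  rw [Set.eq_singleton_iff_unique_mem]
  exact ⟨fun h x hx hx' => h.2 x ⟨hx, hx'⟩, fun h => ⟨⟨hK, hL⟩, fun x hx => h x hx.1 hx.2⟩⟩

theorem zero_mem_contrR {X Y : Type*} (V : Submodule F (X ⊕ Y → F)) :
    (0 : Y → F) ∈ contrR (V : Set (X ⊕ Y → F)) := by
  simp [contrR]

/-- **Rigidity of a connection of two rigid multiports.** With `A = A₂ ⊎ A₁` and
`C = C₂ ⊎ C₁`, the pair `{V_AB ⊕ V_CD, V_B ⊕ V_D ⊕ V_{A₁C₁}}` is rigid iff the pairs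
`{V_AB, V_B}`, `{V_CD, V_D}` and `{(V_AB ↔ V_B) ⊕ (V_CD ↔ V_D), V_{A₁C₁}}` are rigid. -/
theorem connection_rigid
    [Fintype A₂] [Fintype A₁] [Fintype B] [Fintype C₂] [Fintype C₁] [Fintype D]
    (VA : Submodule F ((A₂ ⊕ A₁) ⊕ B → F)) (VC : Submodule F ((C₂ ⊕ C₁) ⊕ D → F))
    (VB : Submodule F (B → F)) (VD : Submodule F (D → F))
    (VAC : Submodule F (A₁ ⊕ C₁ → F)) :
    (FullSumSets
        (connRestr (VA : Set ((A₂ ⊕ A₁) ⊕ B → F)) (VC : Set ((C₂ ⊕ C₁) ⊕ D → F)))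
        (connDevice (VB : Set (B → F)) (VD : Set (D → F)) (VAC : Set (A₁ ⊕ C₁ → F))) ∧
      connContr (VA : Set ((A₂ ⊕ A₁) ⊕ B → F)) (VC : Set ((C₂ ⊕ C₁) ⊕ D → F))
        ∩ connDevice (VB : Set (B → F)) (VD : Set (D → F)) (VAC : Set (A₁ ⊕ C₁ → F))
        = {0}) ↔
    ((FullSumSets (restrR (VA : Set ((A₂ ⊕ A₁) ⊕ B → F))) (VB : Set (B → F)) ∧
        contrR (VA : Set ((A₂ ⊕ A₁) ⊕ B → F)) ∩ (VB : Set (B → F)) = {0}) ∧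
     (FullSumSets (restrR (VC : Set ((C₂ ⊕ C₁) ⊕ D → F))) (VD : Set (D → F)) ∧
        contrR (VC : Set ((C₂ ⊕ C₁) ⊕ D → F)) ∩ (VD : Set (D → F)) = {0}) ∧
     (FullSumSets
          (portRestr (VA : Set ((A₂ ⊕ A₁) ⊕ B → F)) (VC : Set ((C₂ ⊕ C₁) ⊕ D → F))
            (VB : Set (B → F)) (VD : Set (D → F)))
          (VAC : Set (A₁ ⊕ C₁ → F)) ∧
        portContr (VA : Set ((A₂ ⊕ A₁) ⊕ B → F)) (VC : Set ((C₂ ⊕ C₁) ⊕ D → F))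
            (VB : Set (B → F)) (VD : Set (D → F))
          ∩ (VAC : Set (A₁ ⊕ C₁ → F)) = {0})) := by
  have hconn : (0 : (B ⊕ D) ⊕ (A₁ ⊕ C₁) → F) ∈
      connContr (VA : Set ((A₂ ⊕ A₁) ⊕ B → F)) (VC : Set ((C₂ ⊕ C₁) ⊕ D → F)) := by
    simp [connContr]
  have hdev : (0 : (B ⊕ D) ⊕ (A₁ ⊕ C₁) → F) ∈
      connDevice (VB : Set (B → F)) (VD : Set (D → F)) (VAC : Set (A₁ ⊕ C₁ → F)) :=
    ⟨VB.zero_mem, VD.zero_mem, VAC.zero_mem⟩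
  have hport : (0 : A₁ ⊕ C₁ → F) ∈
      portContr (VA : Set ((A₂ ⊕ A₁) ⊕ B → F)) (VC : Set ((C₂ ⊕ C₁) ⊕ D → F)) VB VD :=
    ⟨⟨0, VB.zero_mem, by simp⟩, ⟨0, VD.zero_mem, by simp⟩⟩
  rw [inter_eq_singleton_zero_iff hconn hdev,
    inter_eq_singleton_zero_iff (zero_mem_contrR VA) VB.zero_mem,
    inter_eq_singleton_zero_iff (zero_mem_contrR VC) VD.zero_mem,
    inter_eq_singleton_zero_iff hport VAC.zero_mem]
  constructor
  · rintro ⟨hfull, hzero⟩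
    refine ⟨⟨fun b => ?_, fun b hb hb' => ?_⟩, ⟨fun d => ?_, fun d hd hd' => ?_⟩,
      fun h => ?_, ?_⟩
    · obtain ⟨u, ⟨a, c, ha, -⟩, v, ⟨hv, -, -⟩, huv⟩ := hfull (Sum.elim (Sum.elim b 0) 0)
      exact ⟨_, ⟨_, ha⟩, _, hv, funext fun x => congrFun huv (Sum.inl (Sum.inl x))⟩
    · have h0 := hzero (Sum.elim (Sum.elim b 0) 0)
        ⟨by simpa [contrR, ← Function.comp_assoc] using hb,
          by simp [← Function.comp_assoc]⟩
        ⟨hb', VD.zero_mem, VAC.zero_mem⟩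
      exact funext fun x => congrFun h0 (Sum.inl (Sum.inl x))
    · obtain ⟨u, ⟨a, c, -, hc⟩, v, ⟨-, hv, -⟩, huv⟩ := hfull (Sum.elim (Sum.elim 0 d) 0)
      exact ⟨_, ⟨_, hc⟩, _, hv, funext fun x => congrFun huv (Sum.inl (Sum.inr x))⟩
    · have h0 := hzero (Sum.elim (Sum.elim 0 d) 0)
        ⟨by simp [← Function.comp_assoc],
          by simpa [contrR, ← Function.comp_assoc] using hd⟩
        ⟨VB.zero_mem, hd', VAC.zero_mem⟩
      exact funext fun x => congrFun h0 (Sum.inl (Sum.inr x))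
    · obtain ⟨u, ⟨a, c, ha, hc⟩, v, ⟨hvB, hvD, hvAC⟩, huv⟩ := hfull (Sum.elim 0 h)
      have hB : u ∘ Sum.inl ∘ Sum.inl = -(v ∘ Sum.inl ∘ Sum.inl) :=
        eq_neg_of_add_eq_zero_left
          (funext fun x => (congrFun huv (Sum.inl (Sum.inl x))).symm)
      have hD : u ∘ Sum.inl ∘ Sum.inr = -(v ∘ Sum.inl ∘ Sum.inr) :=
        eq_neg_of_add_eq_zero_left
          (funext fun x => (congrFun huv (Sum.inl (Sum.inr x))).symm)
      exact ⟨u ∘ Sum.inr,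
        ⟨a, c, ⟨_, hB ▸ VB.neg_mem hvB, ha⟩, ⟨_, hD ▸ VD.neg_mem hvD, hc⟩⟩,
        _, hvAC, funext fun x => congrFun huv (Sum.inr x)⟩
    · rintro h ⟨⟨b, hb, hA⟩, ⟨d, hd, hC⟩⟩ hh
      have h0 := hzero (Sum.elim (Sum.elim b d) h) ⟨hA, hC⟩ ⟨hb, hd, hh⟩
      exact funext fun x => congrFun h0 (Sum.inr x)
  · rintro ⟨⟨hfA, hzA⟩, ⟨hfC, hzC⟩, hfP, hzP⟩
    refine ⟨fun h => ?_, ?_⟩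
    · obtain ⟨b, ⟨a, ha⟩, b', hb', hbb⟩ := hfA (h ∘ Sum.inl ∘ Sum.inl)
      obtain ⟨d, ⟨c, hc⟩, d', hd', hdd⟩ := hfC (h ∘ Sum.inl ∘ Sum.inr)
      rw [← Sum.elim_comp_inl_inr a] at ha
      rw [← Sum.elim_comp_inl_inr c] at hc
      obtain ⟨u, ⟨a', c', ⟨b'', hb'', ha'⟩, ⟨d'', hd'', hc'⟩⟩, v, hv, huv⟩ :=
        hfP (h ∘ Sum.inr - Sum.elim (a ∘ Sum.inr) (c ∘ Sum.inr))
      refine ⟨Sum.elim (Sum.elim (b + b'') (d + d''))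
          (Sum.elim (a ∘ Sum.inr + u ∘ Sum.inl) (c ∘ Sum.inr + u ∘ Sum.inr)),
        ⟨_, _, elim_elim_add_mem ha ha', elim_elim_add_mem hc hc'⟩,
        Sum.elim (Sum.elim (b' - b'') (d' - d'')) v,
        ⟨VB.sub_mem hb' hb'', VD.sub_mem hd' hd'', hv⟩, ?_⟩
      ext ((x | x) | (x | x))
      · have := congrFun hbb x
        simp at this ⊢
        linear_combination this
      · have := congrFun hdd x
        simp at this ⊢
        linear_combination this
      · have := congrFun huv (Sum.inl x)
        simp at this ⊢
        linear_combination this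
      · have := congrFun huv (Sum.inr x)
        simp at this ⊢
        linear_combination this
    · rintro h ⟨hA, hC⟩ ⟨hB, hD, hAC⟩
      have h0 : h ∘ Sum.inr = 0 := hzP _ ⟨⟨_, hB, hA⟩, ⟨_, hD, hC⟩⟩ hAC
      have h0A : h ∘ Sum.inr ∘ Sum.inl = (0 : A₁ → F) :=
        funext fun x => congrFun h0 (Sum.inl x)
      have h0C : h ∘ Sum.inr ∘ Sum.inr = (0 : C₁ → F) :=
        funext fun x => congrFun h0 (Sum.inr x)
      rw [h0A, Sum.elim_zero_zero] at hA
      rw [h0C, Sum.elim_zero_zero] at hC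
      have hb := hzA _ hA hB
      have hd := hzC _ hC hD
      ext ((x | x) | x)
      · exact congrFun hb x
      · exact congrFun hd x
      · exact congrFun h0 x

end Connection

end ILA
end

section
/- Port transformation lemma: Let S, P, Q be pairwise disjoint finite sets and let V_SP, V_SQ be vector spaces on S⊎P and S⊎Q over a field F. Then V_SP×S = V_SQ×S and V_SP∘S = V_SQ∘S hold if and only if there exists a vector space V_PQ on P⊎Q such that V_SP ↔ V_PQ = V_SQ, V_SP∘P = V_PQ∘P, and V_SP×P = V_PQ×P. -/
namespace ILA

variable {F : Type*} [Field F]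

theorem elim_sub_elim {X Y : Type*} (f f' : X → F) (g g' : Y → F) :
    Sum.elim f g - Sum.elim f' g' = Sum.elim (f - f') (g - g') := by
  ext (x | y) <;> rfl

theorem elim_sub_mem {X Y : Type*} {V : Submodule F (X ⊕ Y → F)} {f f' : X → F} {g g' : Y → F}
    (h : Sum.elim f g ∈ V) (h' : Sum.elim f' g' ∈ V) : Sum.elim (f - f') (g - g') ∈ V :=
  elim_sub_elim f f' g g' ▸ V.sub_mem h h'

/-- `matchedL` of two subspaces, as a subspace. -/
def matchedLSubmodule {S P Q : Type*} (V₁ : Submodule F (S ⊕ P → F))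
    (V₃ : Submodule F (S ⊕ Q → F)) : Submodule F (P ⊕ Q → F) where
  carrier := matchedL (V₁ : Set (S ⊕ P → F)) (V₃ : Set (S ⊕ Q → F))
  zero_mem' := by
    refine ⟨0, ?_, ?_⟩
    · rw [SetLike.mem_coe]
      convert V₁.zero_mem using 1
      ext (x | x) <;> rfl
    · rw [SetLike.mem_coe]
      convert V₃.zero_mem using 1
      ext (x | x) <;> rfl
  add_mem' := by
    rintro a b ⟨s, hs₁, hs₃⟩ ⟨t, ht₁, ht₃⟩
    refine ⟨s + t, ?_, ?_⟩
    · rw [SetLike.mem_coe]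
      convert V₁.add_mem hs₁ ht₁ using 1
      ext (x | x) <;> rfl
    · rw [SetLike.mem_coe]
      convert V₃.add_mem hs₃ ht₃ using 1
      ext (x | x) <;> rfl
  smul_mem' := by
    rintro c a ⟨s, hs₁, hs₃⟩
    refine ⟨c • s, ?_, ?_⟩
    · rw [SetLike.mem_coe]
      convert V₁.smul_mem c hs₁ using 1
      ext (x | x) <;> rfl
    · rw [SetLike.mem_coe]
      convert V₃.smul_mem c hs₃ using 1
      ext (x | x) <;> rfl

theorem elim_mem_matchedLSubmodule {S P Q : Type*} {V₁ : Submodule F (S ⊕ P → F)}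
    {V₃ : Submodule F (S ⊕ Q → F)} {p : P → F} {q : Q → F} :
    Sum.elim p q ∈ matchedLSubmodule V₁ V₃ ↔
      ∃ s : S → F, Sum.elim s p ∈ V₁ ∧ Sum.elim s q ∈ V₃ :=
  Iff.rfl

/-- **Port transformation lemma.** `V₁` on `S ⊎ P` and `V₃` on `S ⊎ Q` satisfy
`V₁×S = V₃×S` and `V₁∘S = V₃∘S` iff there exists a vector space `V₂` on `P ⊎ Q` with
`V₁ ↔ V₂ = V₃`, `V₁∘P = V₂∘P` and `V₁×P = V₂×P`. -/
theorem port_transformation {S P Q : Type*} [Fintype S] [Fintype P] [Fintype Q]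
    (V₁ : Submodule F (S ⊕ P → F)) (V₃ : Submodule F (S ⊕ Q → F)) :
    (contrL (V₁ : Set (S ⊕ P → F)) = contrL (V₃ : Set (S ⊕ Q → F)) ∧
      restrL (V₁ : Set (S ⊕ P → F)) = restrL (V₃ : Set (S ⊕ Q → F))) ↔
    ∃ V₂ : Submodule F (P ⊕ Q → F),
      matched (V₁ : Set (S ⊕ P → F)) (V₂ : Set (P ⊕ Q → F)) = (V₃ : Set (S ⊕ Q → F)) ∧
      restrR (V₁ : Set (S ⊕ P → F)) = restrL (V₂ : Set (P ⊕ Q → F)) ∧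
      contrR (V₁ : Set (S ⊕ P → F)) = contrL (V₂ : Set (P ⊕ Q → F)) := by
  simp only [Set.ext_iff, contrL, restrL, contrR, restrR, matched, Set.mem_ofPred_eq,
    SetLike.mem_coe]
  constructor
  · rintro ⟨hc, hr⟩
    refine ⟨matchedLSubmodule V₁ V₃, fun h => ⟨?_, fun hh => ?_⟩,
      fun p => ⟨?_, ?_⟩, fun p => ⟨fun hp => ?_, ?_⟩⟩
    · rintro ⟨p, hp, s, hs₁, hs₃⟩
      have h₁ : Sum.elim (h ∘ Sum.inl - s) 0 ∈ V₃ :=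
        (hc _).1 (by simpa using elim_sub_mem hp hs₁)
      convert V₃.add_mem h₁ hs₃ using 1
      ext (x | x) <;> simp
    · rw [← Sum.elim_comp_inl_inr h] at hh
      obtain ⟨p, hp⟩ := (hr _).2 ⟨_, hh⟩
      exact ⟨p, hp, _, hp, hh⟩
    · rintro ⟨f, hf⟩
      obtain ⟨q, hq⟩ := (hr f).1 ⟨p, hf⟩
      exact ⟨q, f, hf, hq⟩
    · rintro ⟨q, s, hs, -⟩
      exact ⟨s, hs⟩
    · exact elim_mem_matchedLSubmodule.2 ⟨0, hp, (hc 0).1 (by simp)⟩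
    · rintro ⟨s, hs₁, hs₃⟩
      simpa using elim_sub_mem hs₁ ((hc s).2 hs₃)
  · rintro ⟨V₂, hm, hr, hc⟩
    have mem_V₃ (f : S → F) (q : Q → F) :
        Sum.elim f q ∈ V₃ ↔ ∃ p, Sum.elim f p ∈ V₁ ∧ Sum.elim p q ∈ V₂ :=
      (hm (Sum.elim f q)).symm
    refine ⟨fun f => ⟨fun hf => (mem_V₃ f 0).2 ⟨0, hf, (hc 0).1 (by simp)⟩, fun hf => ?_⟩,
      fun f => ⟨?_, ?_⟩⟩
    · obtain ⟨p, hp, hp₂⟩ := (mem_V₃ f 0).1 hf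
      simpa using elim_sub_mem hp ((hc p).2 hp₂)
    · rintro ⟨p, hp⟩
      obtain ⟨q, hq⟩ := (hr p).1 ⟨f, hp⟩
      exact ⟨q, (mem_V₃ f q).2 ⟨p, hp, hq⟩⟩
    · rintro ⟨q, hq⟩
      obtain ⟨p, hp, -⟩ := (mem_V₃ f q).1 hq
      exact ⟨p, hp⟩

end ILA
end
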